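/- arXiv:2206.14760 — 2 statements merged into one kernel-verified Lean document; each statement's English description precedes it below -/
import Mathlib

section
/- Let n ≥ 2 and 1 ≤ k ≤ n, let C be a nonempty closed convex subset of ℝ with C ⊆ [0,∞), and let y ∈ ℝⁿ, equipped with the Euclidean norm. For a subset K of {1,…,n}, S_K denotes the set of vectors x ∈ ℝⁿ with x_i ∈ C for every i ∈ K and x_i = 0 for every i ∉ K. Let K* be a subset of {1,…,n} of cardinality k consisting of indices of k largest components of y, i.e., y_i ≥ y_j for all i ∈ K* and all j ∉ K*. Then for every subset K of {1,…,n} of cardinality k, inf_{x ∈ S_{K*}} (1/2)‖x − y‖² ≤ inf_{x ∈ S_K} (1/2)‖x − y‖²; i.e., K* is an optimal index set for the problem min_{x_K, x_i ∈ C} (1/2)‖x_K − y‖². -/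
theorem exists_perm_aux {n : ℕ} (A B : Finset (Fin n)) (h : A.card = B.card) :
    ∃ σ : Equiv.Perm (Fin n), (∀ i ∈ A, σ i ∈ B) ∧ (∀ i ∉ A, σ i ∉ B) ∧
      ∀ i ∈ A, σ i = i ∨ σ i ∉ A := by
  let e : ↥(A \ B) ≃ ↥(B \ A) := Finset.equivOfCardEq (Finset.card_sdiff_comm h)
  let f : Fin n → Fin n := fun i =>
    if hi : i ∈ A \ B then (e ⟨i, hi⟩ : Fin n)
    else if hj : i ∈ B \ A then (e.symm ⟨i, hj⟩ : Fin n) else i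
  have f1 : ∀ i (hi : i ∈ A \ B), f i = e ⟨i, hi⟩ := fun i hi => by simp only [f, dif_pos hi]
  have f2 : ∀ i (hi : i ∈ B \ A), f i = e.symm ⟨i, hi⟩ := fun i hi => by
    have : i ∉ A \ B := by simp at hi ⊢; tauto
    simp only [f, dif_neg this, dif_pos hi]
  have f3 : ∀ i, i ∉ A \ B → i ∉ B \ A → f i = i := fun i h1 h2 => by
    simp only [f, dif_neg h1, dif_neg h2]
  have g1 : ∀ i, i ∈ A \ B → f i ∈ B \ A := fun i hi => by rw [f1 i hi]; exact (e _).2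
  have g2 : ∀ i, i ∈ B \ A → f i ∈ A \ B := fun i hi => by rw [f2 i hi]; exact (e.symm _).2
  have hf : Function.Involutive f := by
    intro i
    by_cases h1 : i ∈ A \ B
    · rw [f2 _ (g1 i h1)]
      simp [f1 i h1]
    · by_cases h2 : i ∈ B \ A
      · rw [f1 _ (g2 i h2)]
        simp [f2 i h2]
      · rw [f3 i h1 h2, f3 i h1 h2]
  simp only [Finset.mem_sdiff] at f3 g1 g2
  refine ⟨hf.toPerm f, fun i hi => ?_, fun i hi => ?_, fun i hi => ?_⟩ <;>
    simp only [Function.Involutive.coe_toPerm] <;> clear_value f <;> grind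

/-- Proposition 1: the set of indices of the `k` largest components of `y` is an
optimal support for the cardinality-constrained projection problem. -/
theorem best_support_of_k_largest
    (n k : ℕ) (hn : 2 ≤ n) (hk1 : 1 ≤ k) (hkn : k ≤ n)
    (C : Set ℝ) (hCne : C.Nonempty) (hCcl : IsClosed C) (hCcv : Convex ℝ C)
    (hC0 : C ⊆ Set.Ici (0 : ℝ))
    (y : EuclideanSpace ℝ (Fin n))
    (Kstar : Finset (Fin n)) (hKstar : Kstar.card = k)
    (hlargest : ∀ i ∈ Kstar, ∀ j ∉ Kstar, y j ≤ y i) :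
    ∀ K : Finset (Fin n), K.card = k →
      sInf ((fun x => (1 / 2 : ℝ) * ‖x - y‖ ^ 2) ''
          {x : EuclideanSpace ℝ (Fin n) | (∀ i ∈ Kstar, x i ∈ C) ∧ ∀ i ∉ Kstar, x i = 0})
        ≤ sInf ((fun x => (1 / 2 : ℝ) * ‖x - y‖ ^ 2) ''
          {x : EuclideanSpace ℝ (Fin n) | (∀ i ∈ K, x i ∈ C) ∧ ∀ i ∉ K, x i = 0}) := by
  intro K hK
  obtain ⟨σ, h1, h2, h3⟩ := exists_perm_aux Kstar K (hKstar.trans hK.symm)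
  apply le_csInf
  · obtain ⟨c, hc⟩ := hCne
    refine Set.Nonempty.image _ ⟨WithLp.toLp 2 (fun i => if i ∈ K then c else 0), ?_, ?_⟩
    · intro i hi
      simpa [hi] using hc
    · intro i hi
      simp [hi]
  · rintro _ ⟨x, ⟨hx1, hx2⟩, rfl⟩
    have hbdd : BddBelow ((fun x => (1 / 2 : ℝ) * ‖x - y‖ ^ 2) ''
          {x : EuclideanSpace ℝ (Fin n) | (∀ i ∈ Kstar, x i ∈ C) ∧ ∀ i ∉ Kstar, x i = 0}) := by
      refine ⟨0, ?_⟩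
      rintro _ ⟨z, _, rfl⟩
      positivity
    refine (csInf_le hbdd ⟨WithLp.toLp 2 (fun i => x (σ i)), ⟨?_, ?_⟩, rfl⟩).trans ?_
    · intro i hi
      exact hx1 _ (h1 i hi)
    · intro i hi
      exact hx2 _ (h2 i hi)
    · simp only [EuclideanSpace.real_norm_sq_eq, PiLp.sub_apply]
      have e : ∑ i, (x i - y i) ^ 2 = ∑ i, (x (σ i) - y (σ i)) ^ 2 :=
        (Equiv.sum_comp σ (fun i => (x i - y i) ^ 2)).symm
      have e2 : ∑ i, y i ^ 2 = ∑ i, y (σ i) ^ 2 :=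
        (Equiv.sum_comp σ (fun i => y i ^ 2)).symm
      have e3 : ∑ i, ((x (σ i) - y i) ^ 2 - y i ^ 2)
          ≤ ∑ i, ((x (σ i) - y (σ i)) ^ 2 - y (σ i) ^ 2) := by
        apply Finset.sum_le_sum
        intro i _
        by_cases hi : i ∈ Kstar
        · have hp : 0 ≤ x (σ i) := hC0 (hx1 _ (h1 i hi))
          have hy : y (σ i) ≤ y i := by
            rcases h3 i hi with h | h
            · rw [h]
            · exact hlargest i hi _ h
          nlinarith [mul_le_mul_of_nonneg_left hy hp]
        · rw [hx2 _ (h2 i hi)]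
          simp
      rw [Finset.sum_sub_distrib, Finset.sum_sub_distrib] at e3
      linarith
end

section
/- Let P be a nonempty finite set of points of ℝⁿ, let f : ℝⁿ → ℝ be an objective function and ψ : ℝⁿ → ℝ a constraint function; call a point x feasible if ψ(x) ≤ 0. Assume: (i) f is not constant on P; let f_min and f_max be the minimum and maximum of f over P and set f̂(x) = (f(x) − f_min)/(f_max − f_min); (ii) ž ∈ P is feasible and f(ž) ≤ f(x) for every feasible x ∈ P; (iii) if P contains infeasible points, let ψ_max = max{ψ(x) : x ∈ P, ψ(x) > 0} and set Ψ(x) = max(ψ(x), 0)/ψ_max, while Ψ ≡ 0 if every point of P is feasible; (iv) let R_f be the fraction of points of P that are feasible. Define the penalty function on P by F(x) = f̂(x) if ψ(x) ≤ 0; F(x) = f̂(ž) + R_f·Ψ(x) if ψ(x) > 0 and f(x) ≤ f(ž); F(x) = f̂(x) + R_f·Ψ(x) if ψ(x) > 0 and f(x) > f(ž). Then a point x* ∈ P minimizes F over P if and only if ψ(x*) ≤ 0 and f(x*) = f(ž); in particular, every minimizer of F over P is a feasible point that minimizes f over the feasible points of P. -/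
open Classical in
/-- Proposition 4: the self-adaptive penalty function `F` is exact on the finite
population `P`: a point minimizes `F` over `P` iff it is feasible and attains the
best feasible objective value. -/
theorem adaptive_penalty_exact
    (n : ℕ) (P : Finset (Fin n → ℝ)) (hP : P.Nonempty)
    (f ψ : (Fin n → ℝ) → ℝ)
    (hnonconst : ∃ a ∈ P, ∃ b ∈ P, f a ≠ f b)
    (fmin fmax : ℝ) (hfmin : fmin = P.inf' hP f) (hfmax : fmax = P.sup' hP f)
    (fhat : (Fin n → ℝ) → ℝ)
    (hfhat : ∀ x, fhat x = (f x - fmin) / (fmax - fmin))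
    (z : Fin n → ℝ) (hzP : z ∈ P) (hzfeas : ψ z ≤ 0)
    (hzbest : ∀ x ∈ P, ψ x ≤ 0 → f z ≤ f x)
    (ψmax : ℝ)
    (hψmax : ∀ h : (P.filter fun x => 0 < ψ x).Nonempty,
      ψmax = (P.filter fun x => 0 < ψ x).sup' h ψ)
    (Ψ : (Fin n → ℝ) → ℝ)
    (hΨ : ∀ x, Ψ x = if ∃ p ∈ P, 0 < ψ p then max (ψ x) 0 / ψmax else 0)
    (Rf : ℝ) (hRf : Rf = ((P.filter fun x => ψ x ≤ 0).card : ℝ) / (P.card : ℝ))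
    (F : (Fin n → ℝ) → ℝ)
    (hF : ∀ x, F x =
      if ψ x ≤ 0 then fhat x
      else if f x ≤ f z then fhat z + Rf * Ψ x
      else fhat x + Rf * Ψ x) :
    ∀ xstar ∈ P, ((∀ x ∈ P, F xstar ≤ F x) ↔ (ψ xstar ≤ 0 ∧ f xstar = f z)) := by
  have hD : 0 < fmax - fmin := by
    obtain ⟨a, ha, b, hb, hab⟩ := hnonconst
    have h1 : fmin ≤ f a := hfmin ▸ Finset.inf'_le f ha
    have h2 : fmin ≤ f b := hfmin ▸ Finset.inf'_le f hb
    have h3 : f a ≤ fmax := hfmax ▸ Finset.le_sup' f ha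
    have h4 : f b ≤ fmax := hfmax ▸ Finset.le_sup' f hb
    rcases lt_or_gt_of_ne hab with h | h <;> linarith
  have hle : ∀ x y, fhat x ≤ fhat y ↔ f x ≤ f y := by
    intro x y
    rw [hfhat, hfhat, div_le_div_iff_of_pos_right hD]
    constructor <;> intro h <;> linarith
  have hR : 0 < Rf := by
    have h1 : 0 < (P.filter fun x => ψ x ≤ 0).card :=
      Finset.card_pos.mpr ⟨z, Finset.mem_filter.mpr ⟨hzP, hzfeas⟩⟩
    have h2 : 0 < P.card := Finset.card_pos.mpr hP
    rw [hRf]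
    positivity
  have hinf : ∀ x ∈ P, ¬ ψ x ≤ 0 → fhat z < F x := by
    intro x hx hpos
    have hp := not_le.mp hpos
    have hmem : x ∈ P.filter fun x => 0 < ψ x := Finset.mem_filter.mpr ⟨hx, hp⟩
    have hm : ψ x ≤ ψmax := by
      rw [hψmax ⟨x, hmem⟩]
      exact Finset.le_sup' ψ hmem
    have hΨx : 0 < Ψ x := by
      rw [hΨ, if_pos ⟨x, hx, hp⟩]
      exact div_pos (lt_max_of_lt_left hp) (hp.trans_le hm)
    have hmul := mul_pos hR hΨx
    rw [hF, if_neg hpos]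
    split_ifs with h
    · linarith
    · have := (hle z x).mpr (not_le.mp h).le
      linarith
  have hFz : F z = fhat z := by rw [hF, if_pos hzfeas]
  intro s hs
  constructor
  · intro h
    have hz := h z hzP
    rw [hFz] at hz
    by_cases hf : ψ s ≤ 0
    · rw [hF, if_pos hf, hle] at hz
      exact ⟨hf, le_antisymm hz (hzbest s hs hf)⟩
    · exact absurd hz (not_le.mpr (hinf s hs hf))
  · rintro ⟨hf, he⟩ x hx
    have h1 : F s ≤ fhat z := by
      rw [hF, if_pos hf, hle]
      exact he.le
    refine h1.trans ?_
    by_cases hfx : ψ x ≤ 0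
    · rw [hF, if_pos hfx, hle]
      exact hzbest x hx hfx
    · exact (hinf x hx hfx).le
end
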